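/- Assume n_3 > n_2 (so n_1 < n_2 < n_3 < n_4 and n = n_4). Fix a Smith datum (U^{(2)}, V^{(2)}, d^{(2)}_1 | … | d^{(2)}_{s_2}) for the stacked matrix (E_{11}; E_{12}), and define H_2 = #{(u_1,…,u_{r_2}) ∈ (F_q^*)^{r_2} : Σ_{i=1}^{r_2} a_{1,i} u_i = b_1 and u satisfies the index condition for ((E_{11}; E_{12}), U^{(2)}, d^{(2)})}. Then the number of x ∈ F_q^n such that f_1(x) = 0, f_2(x) = 0, x^{E^{(1)}_i} ≠ 0 for all 1 ≤ i ≤ r_2, and x^{E^{(2)}_j} = 0 for all 1 ≤ j ≤ r_4 equals q^{n_4−n_3}(q^{n_3−n_2} − (q−1)^{n_3−n_2}) · H_2 · (q−1)^{n_2−s_2} · ∏_{j=1}^{s_2} gcd(q−1, d^{(2)}_j) if b_2 = 0, and equals 0 otherwise. -/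

import Mathlib

open Finset

/-- Stack the first `p1` rows of `E1` on top of the first `p2` rows of `E2`,
viewed as an integer matrix with `n` columns. -/
def stackM (E1 E2 : ℕ → ℕ → ℕ) (p1 p2 n : ℕ) :
    Matrix (Fin (p1 + p2)) (Fin n) ℤ :=
  Matrix.of fun i j =>
    if (i : ℕ) < p1 then (E1 (i : ℕ) (j : ℕ) : ℤ) else (E2 ((i : ℕ) - p1) (j : ℕ) : ℤ)

/-- `(U, V, d 0 ∣ d 1 ∣ ⋯ ∣ d (s-1))` is a Smith datum for the matrix `M`:
`U` and `V` are unimodular and `U * M * V` is diagonal with the positive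
invariant factors `d 0 ∣ ⋯ ∣ d (s-1)` on the diagonal and zeros elsewhere. -/
def IsSmithDatum {ρ n : ℕ} (M : Matrix (Fin ρ) (Fin n) ℤ)
    (U : Matrix (Fin ρ) (Fin ρ) ℤ) (V : Matrix (Fin n) (Fin n) ℤ)
    (s : ℕ) (d : ℕ → ℕ) : Prop :=
  IsUnit U.det ∧ IsUnit V.det ∧ s ≤ ρ ∧ s ≤ n ∧
    (∀ j, j < s → 0 < d j) ∧ (∀ j, j + 1 < s → d j ∣ d (j + 1)) ∧
    ∀ i k, (U * M * V) i k =
      if (i : ℕ) = (k : ℕ) ∧ (i : ℕ) < s then (d (i : ℕ) : ℤ) else 0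

/-- The index condition: writing `h' = U ⬝ w` (where `w` is the vector of
indices of the `uᵢ`), one has `gcd (m, d j) ∣ h'_j` for `j < s` and
`m ∣ h'_j` for `s ≤ j`. Here `m` plays the role of `q - 1`. -/
def IndexCond {ρ : ℕ} (m : ℕ) (U : Matrix (Fin ρ) (Fin ρ) ℤ)
    (s : ℕ) (d : ℕ → ℕ) (w : Fin ρ → ℤ) : Prop :=
  ∀ j : Fin ρ,
    (if (j : ℕ) < s then ((Nat.gcd m (d (j : ℕ))) : ℤ) else (m : ℤ)) ∣ (U.mulVec w) j

/-- The number of invariant factors is at most the number of columns that can be nonzero. -/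
theorem IsSmithDatum.le_of_column_eq_zero {ρ n : ℕ} {M : Matrix (Fin ρ) (Fin n) ℤ}
    {U : Matrix (Fin ρ) (Fin ρ) ℤ} {V : Matrix (Fin n) (Fin n) ℤ} {s : ℕ} {d : ℕ → ℕ}
    (h : IsSmithDatum M U V s d) {k : ℕ} (hM : ∀ i (j : Fin n), k ≤ j → M i j = 0) : s ≤ k := by
  obtain ⟨hU, hV, hsρ, hsn, hd, -, hD⟩ := h
  have hsub : ((U * M * V).submatrix (Fin.castLE hsρ) (Fin.castLE hsn)) =
      Matrix.diagonal fun i : Fin s => (d i : ℤ) := by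
    ext i j
    simp [hD, Matrix.diagonal_apply, Fin.ext_iff]
  have hs : s ≤ (U * M * V).rank := by
    have h1 := Matrix.rank_submatrix_le (U * M * V) (Fin.castLE hsρ) (Fin.castLE hsn)
    rw [hsub, Matrix.rank_of_det_ne_zero] at h1
    · simpa using h1
    · rw [Matrix.det_diagonal]
      exact Finset.prod_ne_zero_iff.2 fun i _ => by exact_mod_cast (hd i i.2).ne'
  rw [Matrix.rank_mul_eq_left_of_isUnit_det _ _ hV,
    Matrix.rank_mul_eq_right_of_isUnit_det _ _ hU] at hs
  by_contra! hk
  have h2 : M.rank ≤ k := by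
    have hfac : M = (M.submatrix id (Fin.castLE (hk.le.trans hsn))) *
        (Matrix.of fun (i : Fin k) (j : Fin n) => if (i : ℕ) = j then (1 : ℤ) else 0) := by
      ext i j
      rw [Matrix.mul_apply]
      by_cases hj : (j : ℕ) < k
      · rw [Finset.sum_eq_single ⟨j, hj⟩]
        · simp
        · intro b _ hb
          simp [Fin.ext_iff] at hb
          simp [hb]
        · simp
      · rw [hM i j (by omega), Finset.sum_eq_zero]
        intro b _
        have : (b : ℕ) ≠ j := by omega
        simp [this]
    rw [hfac]
    exact (Matrix.rank_mul_le_left _ _).trans (Matrix.rank_le_width _)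
  omega

theorem gcd_dvd_of_mul_eq {m d : ℕ} {h : ℤ} {z : ZMod m} (hz : (d : ZMod m) * z = h) :
    (Nat.gcd m d : ℤ) ∣ h := by
  obtain ⟨t, rfl⟩ := ZMod.intCast_surjective z
  have h1 : ((d * t - h : ℤ) : ZMod m) = 0 := by push_cast; rw [hz, sub_self]
  rw [ZMod.intCast_zmod_eq_zero_iff_dvd] at h1
  have h2 : (Nat.gcd m d : ℤ) ∣ d * t - h :=
    (Int.natCast_dvd_natCast.2 (Nat.gcd_dvd_left m d)).trans h1
  have h3 : (Nat.gcd m d : ℤ) ∣ d * t :=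
    (Int.natCast_dvd_natCast.2 (Nat.gcd_dvd_right m d)).mul_right t
  simpa using dvd_sub h3 h2

/-- The number of solutions of a solvable linear congruence. -/
theorem card_mul_eq_intCast {m : ℕ} [NeZero m] {d : ℕ} {h : ℤ} (hdvd : (Nat.gcd m d : ℤ) ∣ h) :
    Nat.card {z : ZMod m // (d : ZMod m) * z = h} = Nat.gcd m d := by
  obtain ⟨c, hc⟩ := hdvd
  obtain ⟨z₀, hz₀⟩ : ∃ z : ZMod m, (d : ZMod m) * z = h := by
    refine ⟨(Nat.gcdB m d * c : ℤ), ?_⟩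
    rw [hc, Nat.gcd_eq_gcd_ab]
    push_cast
    simp [mul_assoc]
  have hker := IsAddCyclic.card_nsmulAddMonoidHom_ker (G := ZMod m) d
  rw [Nat.card_zmod] at hker
  rw [← hker]
  refine Nat.card_congr ((Equiv.subRight z₀).subtypeEquiv fun z => ?_)
  simp [AddMonoidHom.mem_ker, mul_sub, hz₀, sub_eq_zero]

/-- The number of solutions modulo `m` of a diagonal linear system. -/
theorem card_diagonal_system {m : ℕ} [NeZero m] {ρ n s : ℕ} (hsρ : s ≤ ρ) (hsn : s ≤ n)
    (d : ℕ → ℕ) (D : Matrix (Fin ρ) (Fin n) ℤ)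
    (hD : ∀ i k, D i k = if (i : ℕ) = (k : ℕ) ∧ (i : ℕ) < s then (d (i : ℕ) : ℤ) else 0)
    (h : Fin ρ → ℤ) [Decidable (∀ j : Fin ρ,
      (if (j : ℕ) < s then ((Nat.gcd m (d (j : ℕ))) : ℤ) else (m : ℤ)) ∣ h j)] :
    Nat.card {z : Fin n → ZMod m // ∀ i, ∑ k, (D i k : ZMod m) * z k = h i} =
      if ∀ j : Fin ρ, (if (j : ℕ) < s then ((Nat.gcd m (d (j : ℕ))) : ℤ) else (m : ℤ)) ∣ h j
      then m ^ (n - s) * ∏ j ∈ range s, Nat.gcd m (d j) else 0 := by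
  have hlt : ∀ (i : Fin ρ) (hi : (i : ℕ) < s) (z : Fin n → ZMod m),
      ∑ k, (D i k : ZMod m) * z k = d i * z ⟨i, hi.trans_le hsn⟩ := by
    intro i hi z
    rw [Finset.sum_eq_single ⟨i, hi.trans_le hsn⟩]
    · simp [hD, hi]
    · intro b _ hb
      have : (i : ℕ) ≠ b := fun h => hb (Fin.ext h.symm)
      simp [hD, this]
    · simp
  have hge : ∀ (i : Fin ρ) (hi : ¬ (i : ℕ) < s) (z : Fin n → ZMod m),
      ∑ k, (D i k : ZMod m) * z k = 0 := by
    intro i hi z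
    simp [hD, hi]
  split_ifs with hcond
  · have key : ∀ z : Fin n → ZMod m, (∀ i, ∑ k, (D i k : ZMod m) * z k = h i) ↔
        ∀ k : Fin n, ∀ hk : (k : ℕ) < s, (d k : ZMod m) * z k = h ⟨k, hk.trans_le hsρ⟩ := by
      intro z
      constructor
      · intro H k hk
        rw [← H, hlt _ hk]
      · intro H i
        by_cases hi : (i : ℕ) < s
        · rw [hlt i hi]
          exact H ⟨i, hi.trans_le hsn⟩ hi
        · have := hcond i
          rw [if_neg hi] at this
          rw [hge i hi, (ZMod.intCast_zmod_eq_zero_iff_dvd _ _).2 this]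
    rw [Nat.card_congr (Equiv.subtypeEquivRight key), Nat.card_congr (Equiv.subtypePiEquivPi (p :=
      fun (k : Fin n) (y : ZMod m) => ∀ hk : (k : ℕ) < s, (d k : ZMod m) * y =
        h ⟨k, hk.trans_le hsρ⟩)), Nat.card_pi]
    have hfac : ∀ k : Fin n, Nat.card {y : ZMod m // ∀ hk : (k : ℕ) < s, (d k : ZMod m) * y =
        h ⟨k, hk.trans_le hsρ⟩} = if (k : ℕ) < s then Nat.gcd m (d k) else m := by
      intro k
      split_ifs with hk
      · have := hcond ⟨k, hk.trans_le hsρ⟩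
        simp only [hk, if_true] at this
        rw [← card_mul_eq_intCast this]
        exact Nat.card_congr (Equiv.subtypeEquivRight fun y => ⟨fun H => H hk, fun H _ => H⟩)
      · rw [Nat.card_congr (Equiv.subtypeUnivEquiv fun y hk' => absurd hk' hk), Nat.card_zmod]
    rw [Finset.prod_congr rfl fun k _ => hfac k,
      Fin.prod_univ_eq_prod_range (fun k => if k < s then Nat.gcd m (d k) else m) n]
    obtain ⟨t, rfl⟩ := Nat.exists_eq_add_of_le hsn
    rw [Finset.prod_range_add, mul_comm]
    congr 1
    · simp
    · exact Finset.prod_congr rfl fun k hk => if_pos (Finset.mem_range.1 hk)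
  · rw [Nat.card_eq_zero]
    left
    refine ⟨fun ⟨z, hz⟩ => hcond fun j => ?_⟩
    split_ifs with hj
    · exact gcd_dvd_of_mul_eq ((hlt j hj z).symm.trans (hz j))
    · rw [← ZMod.intCast_zmod_eq_zero_iff_dvd, ← hz j, hge j hj]

/-- The number of solutions modulo `m` of a linear system, in terms of a Smith datum. -/
theorem IsSmithDatum.card_system {m : ℕ} [NeZero m] {ρ n s : ℕ} {M : Matrix (Fin ρ) (Fin n) ℤ}
    {U : Matrix (Fin ρ) (Fin ρ) ℤ} {V : Matrix (Fin n) (Fin n) ℤ} {d : ℕ → ℕ}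
    (hS : IsSmithDatum M U V s d) (w : Fin ρ → ℤ) [Decidable (IndexCond m U s d w)] :
    Nat.card {z : Fin n → ZMod m // ∀ i, ∑ k, (M i k : ZMod m) * z k = w i} =
      if IndexCond m U s d w then m ^ (n - s) * ∏ j ∈ range s, Nat.gcd m (d j) else 0 := by
  classical
  obtain ⟨hU, hV, hsρ, hsn, -, -, hD⟩ := hS
  have h1 := card_diagonal_system (m := m) hsρ hsn d (U * M * V) hD (U.mulVec w)
  let φ := Int.castRingHom (ZMod m)
  have hU' : IsUnit (U.map φ) := by
    rw [Matrix.isUnit_iff_isUnit_det]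
    exact φ.map_det U ▸ hU.map φ
  have hV' : IsUnit (V.map φ) := by
    rw [Matrix.isUnit_iff_isUnit_det]
    exact φ.map_det V ▸ hV.map φ
  obtain ⟨W, hVW, hWV⟩ := isUnit_iff_exists.1 hV'
  let e : (Fin n → ZMod m) ≃ (Fin n → ZMod m) :=
    { toFun := (V.map φ).mulVec
      invFun := W.mulVec
      left_inv := fun z => by simp [hWV]
      right_inv := fun z => by simp [hVW] }
  have h2 : ∀ z : Fin n → ZMod m,
      (∀ i, ∑ k, (((U * M * V) i k : ℤ) : ZMod m) * z k = ((U.mulVec w i : ℤ) : ZMod m)) ↔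
        ∀ i, ∑ k, (M i k : ZMod m) * e z k = w i := by
    intro z
    have hinj : Function.Injective (U.map φ).mulVec := Matrix.mulVec_injective_of_isUnit hU'
    have e1 : (∀ i, ∑ k, (((U * M * V) i k : ℤ) : ZMod m) * z k =
        ((U.mulVec w i : ℤ) : ZMod m)) ↔
        ((U * M * V).map φ).mulVec z = (U.map φ).mulVec (fun i => (w i : ZMod m)) := by
      rw [funext_iff]
      refine forall_congr' fun i => ?_
      simp [Matrix.mulVec, dotProduct, φ]
    have e2 : (∀ i, ∑ k, (M i k : ZMod m) * e z k = w i) ↔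
        (M.map φ).mulVec (e z) = fun i => (w i : ZMod m) := by
      rw [funext_iff]
      rfl
    rw [e1, e2, ← hinj.eq_iff (a := (M.map φ).mulVec (e z))]
    simp [e, Matrix.map_mul, Matrix.mulVec_mulVec, Matrix.mul_assoc]
  rw [← Nat.card_congr (e.subtypeEquiv h2), h1]
  unfold IndexCond
  congr

/-- The number of solutions of a system of monomial equations in a finite cyclic group, in terms of
a Smith datum of the exponent matrix. -/
theorem IsSmithDatum.card_monomial_system {G : Type*} [CommGroup G] [Finite G] {α : G}
    (hα : ∀ β : G, β ∈ Subgroup.zpowers α) {ρ n s : ℕ} {E : ℕ → ℕ → ℕ}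
    {U : Matrix (Fin ρ) (Fin ρ) ℤ} {V : Matrix (Fin n) (Fin n) ℤ} {d : ℕ → ℕ}
    (hS : IsSmithDatum (Matrix.of fun (i : Fin ρ) (j : Fin n) => (E i j : ℤ)) U V s d)
    (w : Fin ρ → ℤ) [Decidable (IndexCond (Nat.card G) U s d w)] :
    Nat.card {y : Fin n → G // ∀ i : Fin ρ, ∏ j : Fin n, y j ^ E i j = α ^ w i} =
      if IndexCond (Nat.card G) U s d w
      then Nat.card G ^ (n - s) * ∏ j ∈ range s, Nat.gcd (Nat.card G) (d j) else 0 := by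
  have : NeZero (Nat.card G) := ⟨Nat.card_pos.ne'⟩
  rw [← hS.card_system w]
  let f : ZMod (Nat.card G) →+ Additive G :=
    ZMod.lift (Nat.card G) ⟨zmultiplesHom (Additive G) (Additive.ofMul α), by
      rw [zmultiplesHom_apply, natCast_zsmul, ← ofMul_pow, pow_card_eq_one', ofMul_one]⟩
  have hf : ∀ k : ℤ, f k = Additive.ofMul (α ^ k) := fun k => by simp [f]
  have hsurj : Function.Surjective f := fun β => by
    obtain ⟨k, hk⟩ := Subgroup.mem_zpowers_iff.1 (hα β.toMul)
    exact ⟨k, by rw [hf, hk, ofMul_toMul]⟩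
  have hbij : Function.Bijective f :=
    (Nat.bijective_iff_surjective_and_card f).2 ⟨hsurj,
      (Nat.card_zmod _).trans (Nat.card_congr Additive.ofMul)⟩
  refine (Nat.card_congr ((Equiv.piCongrRight fun _ : Fin n =>
    (Equiv.ofBijective f hbij).trans Additive.toMul).subtypeEquiv fun z => ?_)).symm
  refine forall_congr' fun i => ?_
  have : f (∑ k : Fin n, (((E i k : ℕ) : ℤ) : ZMod (Nat.card G)) * z k) =
      Additive.ofMul (∏ k : Fin n, (f (z k)).toMul ^ E i k) := by
    rw [map_sum, ofMul_prod]
    refine Finset.sum_congr rfl fun k _ => ?_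
    rw [Int.cast_natCast, ← nsmul_eq_mul, map_nsmul, ofMul_pow, ofMul_toMul]
  simp only [Matrix.of_apply]
  rw [← hbij.1.eq_iff, hf, this, Additive.ofMul.injective.eq_iff]
  rfl

theorem prod_pow_append_eq {M : Type*} [CommMonoid M] {k l : ℕ} (x : Fin k → M) (y : Fin l → M)
    {e : ℕ → ℕ} (he : ∀ j, k ≤ j → e j = 0) :
    ∏ j : Fin (k + l), Fin.append x y j ^ e j = ∏ j : Fin k, x j ^ e j := by
  simp [Fin.prod_univ_add, he]

theorem prod_pow_eq_zero_iff {F : Type*} [Field F] {n k : ℕ} (x : Fin n → F)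
    {e : ℕ → ℕ} (hpos : ∀ j, j < k → 0 < e j) (hzero : ∀ j, k ≤ j → e j = 0) :
    ∏ j : Fin n, x j ^ e j = 0 ↔ ∃ j : Fin n, (j : ℕ) < k ∧ x j = 0 := by
  rw [Finset.prod_eq_zero_iff]
  refine exists_congr fun j => ?_
  by_cases hj : (j : ℕ) < k
  · simp [hj, (hpos j hj).ne']
  · simp [hj, hzero j (not_lt.1 hj)]

/-- The number of vectors over a finite field with some zero coordinate. -/
theorem card_exists_eq_zero (F : Type*) [Field F] [Fintype F] (a : ℕ) :
    Nat.card {v : Fin a → F // ∃ j, v j = 0} =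
      Fintype.card F ^ a - (Fintype.card F - 1) ^ a := by
  classical
  have h1 : Nat.card {v : Fin a → F // ∀ j, v j ≠ 0} = (Fintype.card F - 1) ^ a := by
    rw [Nat.card_congr (Equiv.subtypePiEquivPi (p := fun (_ : Fin a) (y : F) => y ≠ 0)),
      Nat.card_pi, ← Nat.card_congr unitsEquivNeZero, Nat.card_units]
    simp
  have h2 := Nat.card_congr (Equiv.sumCompl fun v : Fin a → F => ∃ j, v j = 0)
  rw [Nat.card_sum, Nat.card_congr (Equiv.subtypeEquivRight (fun v : Fin a → F =>
    show (¬ ∃ j, v j = 0) ↔ ∀ j, v j ≠ 0 by push Not; rfl)), h1] at h2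
  simp at h2
  simp
  omega

/-- The number of points with nonzero coordinates on a hypersurface that involves only the first
`k` of the variables. -/
theorem card_units_solutions_mul {F : Type*} [Field F] [Fintype F] {k l r : ℕ} (a : ℕ → F)
    (b : F) {E : ℕ → ℕ → ℕ} (hE : ∀ i, i < r → ∀ j, k ≤ j → E i j = 0) :
    Nat.card {y : Fin (k + l) → Fˣ //
        ∑ i : Fin r, a i * ((∏ j, y j ^ E i j : Fˣ) : F) = b} =
      Nat.card {y : Fin k → Fˣ // ∑ i : Fin r, a i * ((∏ j, y j ^ E i j : Fˣ) : F) = b} *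
        (Fintype.card F - 1) ^ l := by
  have hl : Nat.card (Fin l → Fˣ) = (Fintype.card F - 1) ^ l := by
    simp [Nat.card_pi, Nat.card_units]
  rw [← hl, ← Nat.card_prod]
  refine Nat.card_congr (Equiv.trans ?_ (Equiv.prodSubtypeFstEquivSubtypeProd (p :=
    fun y : Fin k → Fˣ => ∑ i : Fin r, a i * ((∏ j, y j ^ E i j : Fˣ) : F) = b)))
  refine ((Fin.appendEquiv k l).subtypeEquiv fun y => ?_).symm
  have : ∀ i : Fin r, ∏ j, Fin.append y.1 y.2 j ^ E i j = ∏ j, y.1 j ^ E i j := fun i =>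
    prod_pow_append_eq _ _ (hE i i.2)
  simp [Fin.appendEquiv, this]

/-- The number of points with nonzero coordinates on a hypersurface, in terms of a Smith datum of
its exponent matrix. -/
theorem IsSmithDatum.card_units_solutions {F : Type*} [Field F] [Fintype F] {α : Fˣ}
    (hα : ∀ β : Fˣ, β ∈ Subgroup.zpowers α) {ind : Fˣ → ℕ} (hind : ∀ β, α ^ ind β = β)
    {n r s : ℕ} {E : ℕ → ℕ → ℕ} {U : Matrix (Fin r) (Fin r) ℤ} {V : Matrix (Fin n) (Fin n) ℤ}
    {d : ℕ → ℕ} (hS : IsSmithDatum (Matrix.of fun (i : Fin r) (j : Fin n) => (E i j : ℤ)) U V s d)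
    (a : ℕ → F) (b : F) :
    Nat.card {y : Fin n → Fˣ // ∑ i : Fin r, a i * ((∏ j, y j ^ E i j : Fˣ) : F) = b} =
      Nat.card {u : Fin r → Fˣ // ∑ i : Fin r, a i * (u i : F) = b ∧
        IndexCond (Nat.card Fˣ) U s d fun i => (ind (u i) : ℤ)} *
        (Nat.card Fˣ ^ (n - s) * ∏ j ∈ range s, Nat.gcd (Nat.card Fˣ) (d j)) := by
  classical
  let g : (Fin n → Fˣ) → (Fin r → Fˣ) := fun y i => ∏ j, y j ^ E i j
  have hfib : ∀ u : Fin r → Fˣ, Nat.card {y // g y = u} =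
      if IndexCond (Nat.card Fˣ) U s d fun i => (ind (u i) : ℤ)
      then Nat.card Fˣ ^ (n - s) * ∏ j ∈ range s, Nat.gcd (Nat.card Fˣ) (d j) else 0 := by
    intro u
    rw [← hS.card_monomial_system hα]
    refine Nat.card_congr (Equiv.subtypeEquivRight fun y => ?_)
    simp [g, funext_iff, hind]
  rw [← Nat.card_congr (Equiv.sigmaSubtypeFiberEquivSubtype g
    (q := fun u => ∑ i : Fin r, a i * (u i : F) = b) fun y => Iff.rfl), Nat.card_sigma]
  simp_rw [hfib]
  rw [← Finset.sum_filter, Finset.sum_const, smul_eq_mul]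
  congr 1
  rw [← Fintype.card_subtype, ← Nat.card_eq_fintype_card]
  exact Nat.card_congr (Equiv.subtypeSubtypeEquivSubtypeInter
    (fun u : Fin r → Fˣ => ∑ i : Fin r, a i * (u i : F) = b)
    fun u => IndexCond (Nat.card Fˣ) U s d fun i => (ind (u i) : ℤ))

/-- The number of vectors whose first `k` coordinates are nonzero and satisfy `P`, and which have a
zero among the next `a` coordinates. -/
theorem card_append_units {F : Type*} [Field F] [Fintype F] {k a c : ℕ}
    (P : (Fin k → F) → Prop) :
    Nat.card {x : Fin (k + a + c) → F //
      P (fun j => x (Fin.castAdd c (Fin.castAdd a j))) ∧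
      (∀ j : Fin (k + a + c), (j : ℕ) < k → x j ≠ 0) ∧
      ∃ j : Fin (k + a + c), (j : ℕ) < k + a ∧ x j = 0} =
    Nat.card {y : Fin k → Fˣ // P fun j => y j} *
      (Fintype.card F ^ a - (Fintype.card F - 1) ^ a) * Fintype.card F ^ c := by
  rw [← card_exists_eq_zero F a,
    show Fintype.card F ^ c = Nat.card (Fin c → F) by simp,
    ← Nat.card_prod, ← Nat.card_prod]
  symm
  refine Nat.card_congr (Equiv.ofBijective (fun t => ⟨Fin.append (Fin.append
    (fun j => (t.1.1.1 j : F)) t.1.2.1) t.2, ?_, ?_, ?_⟩) ⟨?_, ?_⟩)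
  · simpa using t.1.1.2
  · intro j hj
    obtain ⟨j, rfl⟩ : ∃ i : Fin k, j = Fin.castAdd c (Fin.castAdd a i) := ⟨⟨j, hj⟩, rfl⟩
    simp
  · obtain ⟨j, hj⟩ := t.1.2.2
    exact ⟨Fin.castAdd c (Fin.natAdd k j), by simp, by simpa using hj⟩
  · rintro ⟨⟨⟨y, hy⟩, v, hv⟩, z⟩ ⟨⟨⟨y', hy'⟩, v', hv'⟩, z'⟩ h
    have h1 := (Fin.appendEquiv (α := F) (k + a) c).injective
      (a₁ := (Fin.append (fun j => (y j : F)) v, z))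
      (a₂ := (Fin.append (fun j => (y' j : F)) v', z'))
      (congrArg Subtype.val h)
    have h2 := (Fin.appendEquiv (α := F) k a).injective
      (a₁ := (fun j => (y j : F), v)) (a₂ := (fun j => (y' j : F), v')) (Prod.ext_iff.1 h1).1
    obtain ⟨-, hz⟩ := Prod.ext_iff.1 h1
    obtain ⟨hy, hv⟩ := Prod.ext_iff.1 h2
    have hyy : y = y' := funext fun j => Units.ext (congrFun hy j)
    simp only at hz hv
    subst hyy hv hz
    rfl
  · rintro ⟨x, hP, hne, j, hj, hxj⟩
    refine ⟨⟨⟨⟨fun i => Units.mk0 (x (Fin.castAdd c (Fin.castAdd a i))) (hne _ i.2), by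
      simpa using hP⟩, ⟨fun i => x (Fin.castAdd c (Fin.natAdd k i)), ?_⟩⟩,
      fun i => x (Fin.natAdd (k + a) i)⟩, ?_⟩
    · have hjk : k ≤ (j : ℕ) := not_lt.1 fun h => hne j h hxj
      refine ⟨⟨j - k, by omega⟩, ?_⟩
      refine (congrArg x (Fin.ext ?_)).trans hxj
      simp
      omega
    · ext i
      refine Fin.addCases (fun i => ?_) (fun i => ?_) i
      · refine Fin.addCases (fun i => ?_) (fun i => ?_) i <;> simp
      · simp

theorem rational_points_E1_nonzero_E2_zero
    (F : Type) [Field F] [Fintype F] [DecidableEq F]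
    (q : ℕ) (hq : q = Fintype.card F)
    (hqpow : ∃ p k : ℕ, Nat.Prime p ∧ Odd p ∧ 0 < k ∧ q = p ^ k)
    (α : Fˣ) (hα : ∀ β : Fˣ, β ∈ Subgroup.zpowers α)
    (ind : Fˣ → ℕ)
    (hind : ∀ β : Fˣ, 1 ≤ ind β ∧ ind β ≤ q - 1 ∧ α ^ ind β = β)
    (r₁ r₂ r₃ r₄ n₁ n₂ n₃ n₄ : ℕ)
    (hr₁ : 0 < r₁) (hr₁₂ : r₁ < r₂) (hr₃ : 0 < r₃) (hr₃₄ : r₃ < r₄)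
    (hn₁ : 0 < n₁) (hn₁₂ : n₁ < n₂) (hn₃ : 0 < n₃) (hn₃₄ : n₃ < n₄)
    (hn₁₃ : n₁ ≤ n₃)
    (b₁ b₂ : F) (a₁ a₂ : ℕ → Fˣ)
    (E₁ E₂ : ℕ → ℕ → ℕ)
    (hE₁p : ∀ i, i < r₁ → ∀ j, j < n₁ → 0 < E₁ i j)
    (hE₁z : ∀ i, i < r₁ → ∀ j, n₁ ≤ j → E₁ i j = 0)
    (hE₁p' : ∀ i, r₁ ≤ i → i < r₂ → ∀ j, j < n₂ → 0 < E₁ i j)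
    (hE₁z' : ∀ i, r₁ ≤ i → i < r₂ → ∀ j, n₂ ≤ j → E₁ i j = 0)
    (hE₂p : ∀ i, i < r₃ → ∀ j, j < n₃ → 0 < E₂ i j)
    (hE₂z : ∀ i, i < r₃ → ∀ j, n₃ ≤ j → E₂ i j = 0)
    (hE₂p' : ∀ i, r₃ ≤ i → i < r₄ → ∀ j, j < n₄ → 0 < E₂ i j)
    (hE₂z' : ∀ i, r₃ ≤ i → i < r₄ → ∀ j, n₄ ≤ j → E₂ i j = 0)
    (h₂₃ : n₂ < n₃)
    (U₂ : Matrix (Fin (r₂)) (Fin (r₂)) ℤ) (V₂ : Matrix (Fin (n₄)) (Fin (n₄)) ℤ)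
    (s₂ : ℕ) (d₂ : ℕ → ℕ)
    (hSD₂ : IsSmithDatum ((Matrix.of fun (i : Fin (r₂)) (j : Fin (n₄)) => (E₁ (i : ℕ) (j : ℕ) : ℤ))) U₂ V₂ s₂ d₂)
    (H₂ : ℕ)
    (hH₂ : H₂ = Nat.card {u : Fin (r₂) → Fˣ //
      (∑ i : Fin (r₂), (a₁ (i : ℕ) : F) * ((u i : F))) = b₁ ∧
      IndexCond (q - 1) U₂ s₂ d₂ fun i => (ind (u i) : ℤ)})
    :
    Nat.card {x : Fin n₄ → F //
      (∑ i ∈ Finset.range r₂, (a₁ i : F) * ∏ j : Fin n₄, x j ^ E₁ i (j : ℕ)) = b₁ ∧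
      (∑ i ∈ Finset.range r₄, (a₂ i : F) * ∏ j : Fin n₄, x j ^ E₂ i (j : ℕ)) = b₂ ∧
      (∀ i, i < r₂ → (∏ j : Fin n₄, x j ^ E₁ i (j : ℕ)) ≠ 0) ∧
      (∀ i, i < r₄ → (∏ j : Fin n₄, x j ^ E₂ i (j : ℕ)) = 0)} =
      if b₂ = 0 then
        q ^ (n₄ - n₃) * (q ^ (n₃ - n₂) - (q - 1) ^ (n₃ - n₂)) *
          (H₂ * (q - 1) ^ (n₂ - s₂) * ∏ j ∈ Finset.range s₂, Nat.gcd (q - 1) (d₂ j))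
      else 0 := by
  classical
  have hm : q - 1 = Nat.card Fˣ := by rw [hq, Nat.card_units, Nat.card_eq_fintype_card]
  have hE₁n : ∀ i, i < r₂ → ∀ j, n₂ ≤ j → E₁ i j = 0 := fun i hi j hj =>
    (lt_or_ge i r₁).elim (fun h => hE₁z i h j (by omega)) fun h => hE₁z' i h hi j hj
  have hs : s₂ ≤ n₂ := hSD₂.le_of_column_eq_zero fun i j hj => by simp [hE₁n i i.2 j hj]
  obtain ⟨a, rfl⟩ := Nat.exists_eq_add_of_le h₂₃.le
  obtain ⟨c, rfl⟩ := Nat.exists_eq_add_of_le hn₃₄.le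
  have hne : ∀ x : Fin (n₂ + a + c) → F,
      (∀ i, i < r₂ → (∏ j, x j ^ E₁ i (j : ℕ)) ≠ 0) ↔
        ∀ j : Fin (n₂ + a + c), (j : ℕ) < n₂ → x j ≠ 0 := by
    intro x
    constructor
    · intro h j hj hx
      exact h r₁ hr₁₂ ((prod_pow_eq_zero_iff x (hE₁p' r₁ le_rfl hr₁₂)
        (hE₁z' r₁ le_rfl hr₁₂)).2 ⟨j, hj, hx⟩)
    · intro h i hi
      rw [Finset.prod_ne_zero_iff]
      intro j _
      by_cases hj : (j : ℕ) < n₂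
      · exact pow_ne_zero _ (h j hj)
      · simp [hE₁n i hi j (not_lt.1 hj)]
  have hzero : ∀ x : Fin (n₂ + a + c) → F,
      (∀ i, i < r₄ → (∏ j, x j ^ E₂ i (j : ℕ)) = 0) ↔
        ∃ j : Fin (n₂ + a + c), (j : ℕ) < n₂ + a ∧ x j = 0 := by
    intro x
    constructor
    · intro h
      exact (prod_pow_eq_zero_iff x (hE₂p 0 hr₃) (hE₂z 0 hr₃)).1 (h 0 (hr₃.trans hr₃₄))
    · rintro ⟨j, hj, hx⟩ i hi
      refine Finset.prod_eq_zero (Finset.mem_univ j) ?_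
      rw [hx, zero_pow]
      rcases lt_or_ge i r₃ with h | h
      · exact (hE₂p i h j hj).ne'
      · exact (hE₂p' i h hi j j.2).ne'
  split_ifs with hb
  · subst hb
    have hH : H₂ = Nat.card {u : Fin r₂ → Fˣ // ∑ i : Fin r₂, (a₁ i : F) * (u i : F) = b₁ ∧
        IndexCond (Nat.card Fˣ) U₂ s₂ d₂ fun i => (ind (u i) : ℤ)} := by rw [hH₂, hm]
    have hA := hSD₂.card_units_solutions hα (fun β => (hind β).2.2) (fun i => (a₁ i : F)) b₁
    rw [← hH] at hA
    have hB := card_units_solutions_mul (k := n₂ + a) (l := c) (fun i => (a₁ i : F)) b₁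
      fun i hi j hj => hE₁n i hi j (by omega)
    rw [card_units_solutions_mul (k := n₂) (l := a) (fun i => (a₁ i : F)) b₁ hE₁n, mul_assoc,
      ← pow_add] at hB
    have hN : Nat.card {y : Fin n₂ → Fˣ //
        ∑ i : Fin r₂, (a₁ i : F) * ((∏ j, y j ^ E₁ i j : Fˣ) : F) = b₁} =
        H₂ * (q - 1) ^ (n₂ - s₂) * ∏ j ∈ Finset.range s₂, Nat.gcd (q - 1) (d₂ j) := by
      have hpos : 0 < (q - 1) ^ (a + c) := pow_pos (hm ▸ Nat.card_pos) _
      rw [← hq] at hB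
      refine Nat.eq_of_mul_eq_mul_right hpos (hB.symm.trans (hA.trans ?_))
      rw [← hm, show n₂ + a + c - s₂ = (n₂ - s₂) + (a + c) by omega, pow_add]
      ring
    have hC := card_append_units (F := F) (k := n₂) (a := a) (c := c)
      fun y => ∑ i ∈ Finset.range r₂, (a₁ i : F) * ∏ j : Fin n₂, y j ^ E₁ i (j : ℕ) = b₁
    have hN' : Nat.card {y : Fin n₂ → Fˣ //
        ∑ i ∈ Finset.range r₂, (a₁ i : F) * ∏ j : Fin n₂, (y j : F) ^ E₁ i (j : ℕ) = b₁} =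
        Nat.card {y : Fin n₂ → Fˣ //
          ∑ i : Fin r₂, (a₁ i : F) * ((∏ j, y j ^ E₁ i j : Fˣ) : F) = b₁} := by
      refine Nat.card_congr (Equiv.subtypeEquivRight fun y => ?_)
      rw [← Fin.sum_univ_eq_sum_range
        (fun i => (a₁ i : F) * ∏ j : Fin n₂, (y j : F) ^ E₁ i (j : ℕ))]
      simp
    rw [hN', hN, ← hq] at hC
    rw [show n₂ + a + c - (n₂ + a) = c by omega,
      show n₂ + a - n₂ = a by omega, mul_assoc, mul_comm, mul_comm (_ - _), ← hC]
    refine Nat.card_congr (Equiv.subtypeEquivRight fun x => ?_)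
    rw [hne, hzero]
    have hx : ∀ i ∈ Finset.range r₂, (a₁ i : F) * ∏ j, x j ^ E₁ i (j : ℕ) =
        (a₁ i : F) * ∏ j : Fin n₂,
          x (Fin.castAdd c (Fin.castAdd a j)) ^ E₁ i (j : ℕ) := by
      intro i hi
      have hi' := hE₁n i (Finset.mem_range.1 hi)
      have h1 : ∀ j : Fin a, E₁ i (n₂ + j) = 0 := fun j => hi' _ (by omega)
      have h2 : ∀ j : Fin c, E₁ i (n₂ + a + j) = 0 := fun j => hi' _ (by omega)
      congr 1
      refine (Fin.prod_univ_add (a := n₂ + a) (b := c)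
        fun j => x j ^ E₁ i (j : ℕ)).trans ?_
      simp [Fin.prod_univ_add (a := n₂) (b := a), h1, h2]
    rw [Finset.sum_congr rfl hx]
    refine and_congr_right fun _ => ⟨fun h => h.2, fun h => ⟨?_, h⟩⟩
    refine Finset.sum_eq_zero fun i hi => ?_
    rw [(hzero x).2 h.2 i (Finset.mem_range.1 hi), mul_zero]
  · rw [Nat.card_eq_zero]
    refine Or.inl ⟨fun ⟨x, _, h, _, hx⟩ => hb ?_⟩
    rw [← h]
    refine Finset.sum_eq_zero fun i hi => ?_
    rw [hx i (Finset.mem_range.1 hi), mul_zero]
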